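/- Let U_1,...,U_n be independent uniform random variables on [-1,1], X = (1/n)∑ U_i, p_X(t) = P(X > t), and m_X(t) = E[X | X > t]. For every t in (0,1) with p_X(t)^{1/n} < n/(n+1), one has m_X(t)/t ≤ 1 + p_X(t)^{1/n} / (n - (n+1) p_X(t)^{1/n}). -/

import Mathlib

open MeasureTheory Set

/-- The distribution of `n` i.i.d. uniform random variables on `[-1,1]`. -/
noncomputable def unifCube (n : ℕ) : Measure (Fin n → ℝ) :=
  Measure.pi fun _ => (2 : ENNReal)⁻¹ • volume.restrict (Icc (-1 : ℝ) 1)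

/-- `X = (1/n) ∑ᵢ Uᵢ`, the average of the coordinates. -/
noncomputable def avgCoord (n : ℕ) (u : Fin n → ℝ) : ℝ := (∑ i, u i) / n

/-- `p_X(t) = P(X > t)`. -/
noncomputable def tailP (n : ℕ) (t : ℝ) : ℝ :=
  (unifCube n {u | t < avgCoord n u}).toReal

/-- `m_X(t) = E[X ∣ X > t]`, the truncated mean. -/
noncomputable def truncMean (n : ℕ) (t : ℝ) : ℝ :=
  (∫ u in {u | t < avgCoord n u}, avgCoord n u ∂(unifCube n)) / tailP n t


/-- The upper tail of the sum of `n` i.i.d. uniform random variables on `[-1,1]`. -/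
noncomputable def sumTail (n : ℕ) (s : ℝ) : ℝ :=
  (unifCube n).real {u | s < ∑ i, u i}

instance isProbabilityMeasure_unif :
    IsProbabilityMeasure ((2 : ENNReal)⁻¹ • volume.restrict (Icc (-1 : ℝ) 1)) := by
  constructor
  simp only [Measure.smul_apply, Measure.restrict_apply_univ, Real.volume_Icc, smul_eq_mul]
  norm_num
  exact ENNReal.inv_mul_cancel (by norm_num) (by norm_num)

instance isProbabilityMeasure_unifCube (n : ℕ) : IsProbabilityMeasure (unifCube n) := by
  unfold unifCube; infer_instance

lemma measurableSet_lt_sum (n : ℕ) (s : ℝ) : MeasurableSet {u : Fin n → ℝ | s < ∑ i, u i} :=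
  measurableSet_lt measurable_const (by fun_prop)

lemma sumTail_nonneg (n : ℕ) (s : ℝ) : 0 ≤ sumTail n s := measureReal_nonneg

lemma sumTail_antitone (n : ℕ) : Antitone (sumTail n) := fun _ _ h =>
  measureReal_mono fun _ hu => lt_of_le_of_lt h hu

lemma sumTail_zero (s : ℝ) : sumTail 0 s = if s < 0 then 1 else 0 := by
  by_cases h : s < 0 <;> simp [sumTail, h]

lemma sumTail_succ (n : ℕ) (s : ℝ) :
    sumTail (n + 1) s = 1 / 2 * ∫ x in (s - 1)..(s + 1), sumTail n x := by
  have hmp := measurePreserving_piFinSuccAbove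
    (fun _ : Fin (n + 1) => (2 : ENNReal)⁻¹ • volume.restrict (Icc (-1 : ℝ) 1)) 0
  have hS : MeasurableSet {z : ℝ × (Fin n → ℝ) | s < z.1 + ∑ i, z.2 i} :=
    measurableSet_lt measurable_const (by fun_prop)
  have h1 := hmp.measure_preimage hS.nullMeasurableSet
  have h2 : (MeasurableEquiv.piFinSuccAbove (fun _ : Fin (n + 1) => ℝ) 0) ⁻¹'
      {z : ℝ × (Fin n → ℝ) | s < z.1 + ∑ i, z.2 i} = {u | s < ∑ i, u i} := by
    ext u
    simp [Fin.sum_univ_succ, MeasurableEquiv.piFinSuccAbove, Fin.tail]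
  rw [h2, Measure.prod_apply hS] at h1
  have h3 : ∀ x : ℝ, (Prod.mk x ⁻¹' {z : ℝ × (Fin n → ℝ) | s < z.1 + ∑ i, z.2 i})
      = {u | s - x < ∑ i, u i} := by
    intro x; ext u; simp [sub_lt_iff_lt_add']
  simp only [h3] at h1
  have h4 : sumTail (n + 1) s =
      ∫ x, sumTail n (s - x) ∂((2 : ENNReal)⁻¹ • volume.restrict (Icc (-1 : ℝ) 1)) := by
    rw [sumTail, measureReal_def, unifCube, h1]
    have hanti : Monotone fun x => unifCube n {u | s - x < ∑ i, u i} := fun x y hxy =>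
      measure_mono fun u hu => lt_of_le_of_lt (sub_le_sub_left hxy s) hu
    exact (integral_toReal hanti.measurable.aemeasurable
      (Filter.Eventually.of_forall fun x => measure_lt_top _ _)).symm
  rw [h4, integral_smul_measure, integral_Icc_eq_integral_Ioc,
    ← intervalIntegral.integral_of_le (by norm_num),
    intervalIntegral.integral_comp_sub_left (sumTail n) s]
  simp [sub_neg_eq_add]

lemma intervalIntegrable_sumTail (n : ℕ) (a b : ℝ) :
    IntervalIntegrable (sumTail n) volume a b :=
  (sumTail_antitone n).intervalIntegrable

lemma sumTail_one (s : ℝ) : sumTail 1 s = (max (1 - s) 0 - max (-1 - s) 0) / 2 := by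
  rw [sumTail_succ]
  have key : ∀ a b : ℝ, a ≤ b → ∫ x in a..b, sumTail 0 x = max (-a) 0 - max (-b) 0 := by
    intro a b hab
    rw [intervalIntegral.integral_of_le hab, integral_Ioc_eq_integral_Ioo]
    have : sumTail 0 = (Iio (0:ℝ)).indicator fun _ => 1 := by
      ext x; simp [sumTail_zero, indicator]
    rw [this, setIntegral_indicator measurableSet_Iio, Ioo_inter_Iio]
    simp only [integral_const, MeasurableSet.univ, measureReal_restrict_apply, univ_inter,
      Real.volume_real_Ioo, smul_eq_mul, mul_one]
    grind
  rw [key _ _ (by linarith)]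
  ring_nf

lemma continuous_sumTail_succ (n : ℕ) : Continuous (sumTail (n + 1)) := by
  have h : sumTail (n + 1) = fun s => 1 / 2 * ((∫ x in (0:ℝ)..(s + 1), sumTail n x) -
      ∫ x in (0:ℝ)..(s - 1), sumTail n x) := by
    ext s
    rw [sumTail_succ, intervalIntegral.integral_interval_sub_left] <;>
      exact intervalIntegrable_sumTail ..
  have hc := intervalIntegral.continuous_primitive (intervalIntegrable_sumTail n) 0
  rw [h]
  fun_prop

lemma sumTail_eq_zero {n : ℕ} {s : ℝ} (h : (n : ℝ) ≤ s) : sumTail n s = 0 := by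
  induction n generalizing s with
  | zero => simpa [sumTail_zero] using h
  | succ n ih =>
    push_cast at h
    rw [sumTail_succ, intervalIntegral.integral_congr (g := fun _ => 0)]
    · simp
    · intro x hx
      rw [uIcc_of_le (by linarith)] at hx
      exact ih (by linarith [hx.1])

lemma sumTail_add_sumTail_neg (n : ℕ) (s : ℝ) :
    sumTail (n + 1) s + sumTail (n + 1) (-s) = 1 := by
  induction n generalizing s with
  | zero => rw [zero_add, sumTail_one, sumTail_one]; grind
  | succ n ih =>
    have h : ∫ x in (-s - 1)..(-s + 1), sumTail (n + 1) x =
        ∫ x in (s - 1)..(s + 1), sumTail (n + 1) (-x) := by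
      rw [intervalIntegral.integral_comp_neg]; ring_nf
    rw [sumTail_succ (n + 1) s, sumTail_succ (n + 1) (-s), h, ← mul_add,
      ← intervalIntegral.integral_add (g := fun x => sumTail (n + 1) (-x))
        (intervalIntegrable_sumTail ..)
        (((continuous_sumTail_succ n).comp continuous_neg).intervalIntegrable _ _)]
    simp only [ih, intervalIntegral.integral_const, smul_eq_mul]
    ring

lemma tailP_eq_sumTail {n : ℕ} (hn : 0 < n) (t : ℝ) : tailP n t = sumTail n (n * t) := by
  have hn' : (0 : ℝ) < n := by exact_mod_cast hn
  simp only [tailP, sumTail, measureReal_def, avgCoord, lt_div_iff₀' hn']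

lemma integrable_avgCoord (n : ℕ) : Integrable (avgCoord n) (unifCube n) := by
  refine Integrable.div_const (integrable_finsetSum _ fun i _ => ?_) _
  refine (measurePreserving_eval (fun _ : Fin n =>
    (2 : ENNReal)⁻¹ • volume.restrict (Icc (-1 : ℝ) 1)) i).integrable_comp_of_integrable
      (g := fun x => x) ?_
  have h : IntegrableOn (fun x : ℝ => x) (Icc (-1) 1) volume := continuous_id.integrableOn_Icc
  exact Integrable.smul_measure h (by simp)

lemma setIntegral_avgCoord {n : ℕ} (hn : 0 < n) {t : ℝ} (ht : 0 < t) :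
    ∫ u in {u | t < avgCoord n u}, avgCoord n u ∂(unifCube n) =
      t * tailP n t + (∫ x in (n * t)..(n * t + n), sumTail n x) / n := by
  have hn' : (0 : ℝ) < n := by exact_mod_cast hn
  have hmeas : MeasurableSet {u | t < avgCoord n u} :=
    measurableSet_lt measurable_const (by unfold avgCoord; fun_prop)
  have hint := integrable_avgCoord n
  have hf : Integrable (fun u => max (avgCoord n u - t) 0) (unifCube n) :=
    (hint.sub (integrable_const t)).pos_part
  have hlayer := hf.integral_eq_integral_meas_lt
    (Filter.Eventually.of_forall fun u => le_max_right _ _)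
  have hsplit : ∫ u, max (avgCoord n u - t) 0 ∂(unifCube n) =
      ∫ u in {u | t < avgCoord n u}, (avgCoord n u - t) ∂(unifCube n) := by
    rw [← integral_indicator hmeas]
    congr 1 with u
    simp only [indicator, mem_ofPred_eq]
    grind
  rw [integral_sub hint.integrableOn (integrable_const t).integrableOn, setIntegral_const,
    smul_eq_mul, measureReal_def] at hsplit
  have htail : ∫ x in Ioi (0 : ℝ), (unifCube n).real {u | x < max (avgCoord n u - t) 0} =
      ∫ x in (0 : ℝ)..1, sumTail n (n * x + n * t) := by
    rw [intervalIntegral.integral_of_le zero_le_one]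
    have h1 : ∀ x ∈ Ioi (0 : ℝ), (unifCube n).real {u | x < max (avgCoord n u - t) 0} =
        sumTail n (n * x + n * t) := by
      intro x hx
      have hx : 0 < x := hx
      rw [sumTail]
      congr 1 with u
      simp only [mem_ofPred_eq, lt_max_iff, not_lt.2 hx.le, or_false, avgCoord, lt_sub_iff_add_lt,
        lt_div_iff₀' hn', mul_add]
    rw [setIntegral_congr_fun measurableSet_Ioi h1]
    refine setIntegral_eq_of_subset_of_forall_sdiff_eq_zero measurableSet_Ioi
      Ioc_subset_Ioi_self fun x hx => sumTail_eq_zero ?_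
    have : 1 < x := by
      by_contra h
      exact hx.2 ⟨hx.1, not_lt.1 h⟩
    nlinarith [mul_pos hn' ht]
  rw [intervalIntegral.integral_comp_mul_add _ hn'.ne'] at htail
  have htail' : (∫ x in (n * t)..(n * t + n), sumTail n x) / n =
      ∫ x in Ioi (0 : ℝ), (unifCube n).real {u | x < max (avgCoord n u - t) 0} := by
    rw [htail, smul_eq_mul, div_eq_inv_mul]
    ring_nf
  rw [htail', ← hlayer, hsplit, tailP]
  ring

/-- `G` has derivative `-D` with `D ≥ 0` continuous, and `D / G ^ (j / (j + 1))` is nondecreasing: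
a division-free form of the concavity of `G ^ (1 / (j + 1))` where `G` is positive. -/
structure RootConcaveTail (j : ℕ) (G D : ℝ → ℝ) : Prop where
  hasDerivAt : ∀ x, HasDerivAt G (-D x) x
  continuous_density : Continuous D
  nonneg : ∀ x, 0 ≤ G x
  density_nonneg : ∀ x, 0 ≤ D x
  density_mul_le : ∀ a x, a ≤ x →
    D a * (G x ^ ((j + 1 : ℝ)⁻¹)) ^ j ≤ D x * (G a ^ ((j + 1 : ℝ)⁻¹)) ^ j

namespace RootConcaveTail

variable {j : ℕ} {G D : ℝ → ℝ}

lemma continuous (h : RootConcaveTail j G D) : Continuous G :=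
  continuous_iff_continuousAt.2 fun x => (h.hasDerivAt x).continuousAt

lemma antitone (h : RootConcaveTail j G D) : Antitone G :=
  antitone_of_deriv_nonpos (fun x => (h.hasDerivAt x).differentiableAt) fun x => by
    rw [(h.hasDerivAt x).deriv]; linarith [h.density_nonneg x]

lemma root_pow (h : RootConcaveTail j G D) (x : ℝ) :
    (G x ^ ((j + 1 : ℝ)⁻¹)) ^ (j + 1) = G x := by
  have := Real.rpow_inv_natCast_pow (h.nonneg x) (Nat.succ_ne_zero j)
  push_cast at this
  exact this

lemma density_mul_integral_le (h : RootConcaveTail j G D) {a b : ℝ} (hab : a ≤ b) :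
    (j + 2) * (D a * ∫ x in a..b, G x) ≤
      (j + 1) * ((G a ^ ((j + 1 : ℝ)⁻¹)) ^ (j + 2) - (G b ^ ((j + 1 : ℝ)⁻¹)) ^ (j + 2)) *
        (G a ^ ((j + 1 : ℝ)⁻¹)) ^ j := by
  have hj : (0 : ℝ) < j + 1 := by positivity
  set p : ℝ := (j + 1 : ℝ)⁻¹ with hp
  have hp0 : 0 < p := inv_pos.2 hj
  have hpow : ∀ x, (G x ^ p) ^ (j + 2) = G x ^ (1 + p) := by
    intro x
    rw [pow_succ, h.root_pow, Real.rpow_add_of_nonneg (h.nonneg x) zero_le_one hp0.le,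
      Real.rpow_one]
  have hcont : Continuous fun x => G x ^ p := h.continuous.rpow_const fun _ => Or.inr hp0.le
  have hint : ∫ x in a..b, D x * G x ^ p = (1 + p)⁻¹ * (G a ^ (1 + p) - G b ^ (1 + p)) := by
    rw [intervalIntegral.integral_eq_sub_of_hasDerivAt
      (f := fun x => -(1 + p)⁻¹ * G x ^ (1 + p))]
    · ring
    · intro x _
      refine (((h.hasDerivAt x).rpow_const (p := 1 + p) (Or.inr (by linarith))).const_mul
        (-(1 + p)⁻¹)).congr_deriv ?_
      have : 1 + p ≠ 0 := by positivity
      rw [add_sub_cancel_left]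
      field_simp
    · exact (h.continuous_density.mul hcont).intervalIntegrable _ _
  have hmono : ∫ x in a..b, D a * G x ≤ ∫ x in a..b, (G a ^ p) ^ j * (D x * G x ^ p) := by
    refine intervalIntegral.integral_mono_on hab
      ((continuous_const.mul h.continuous).intervalIntegrable _ _)
      ((continuous_const.mul (h.continuous_density.mul hcont)).intervalIntegrable _ _) ?_
    intro x hx
    have h1 := mul_le_mul_of_nonneg_right (h.density_mul_le a x hx.1)
      (Real.rpow_nonneg (h.nonneg x) p)
    rw [mul_assoc, ← pow_succ, h.root_pow] at h1
    linarith
  rw [intervalIntegral.integral_const_mul, intervalIntegral.integral_const_mul, hint] at hmono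
  rw [hpow, hpow]
  have h2 : (1 + p)⁻¹ = (j + 1) / (j + 2 : ℝ) := by
    rw [hp]; field_simp; ring
  rw [h2] at hmono
  calc _ ≤ _ := mul_le_mul_of_nonneg_left hmono (by positivity : (0 : ℝ) ≤ j + 2)
    _ = _ := by field_simp

lemma density_sub_mul_integral_le (h : RootConcaveTail j G D) {a b : ℝ} (hab : a ≤ b) :
    (j + 2) * ((D a - D b) * ∫ x in a..b, G x) ≤ (j + 1) * (G a - G b) ^ 2 := by
  have hI : 0 ≤ ∫ x in a..b, G x := intervalIntegral.integral_nonneg hab fun x _ => h.nonneg x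
  have hsq : 0 ≤ ((j : ℝ) + 1) * (G a - G b) ^ 2 := by positivity
  rcases le_or_gt (D a) (D b) with hD | hD
  · have : (D a - D b) * ∫ x in a..b, G x ≤ 0 :=
      mul_nonpos_of_nonpos_of_nonneg (sub_nonpos.2 hD) hI
    have : ((j : ℝ) + 2) * ((D a - D b) * ∫ x in a..b, G x) ≤ 0 :=
      mul_nonpos_of_nonneg_of_nonpos (by positivity) this
    linarith
  have hDa : 0 < D a := (h.density_nonneg b).trans_lt hD
  have hkey := h.density_mul_integral_le hab
  have hratio := h.density_mul_le a b hab
  have hα0 : 0 ≤ G a ^ ((j + 1 : ℝ)⁻¹) := Real.rpow_nonneg (h.nonneg a) _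
  have hβ0 : 0 ≤ G b ^ ((j + 1 : ℝ)⁻¹) := Real.rpow_nonneg (h.nonneg b) _
  have hβα : G b ^ ((j + 1 : ℝ)⁻¹) ≤ G a ^ ((j + 1 : ℝ)⁻¹) :=
    Real.rpow_le_rpow (h.nonneg b) (h.antitone hab) (by positivity)
  rw [← h.root_pow a, ← h.root_pow b] at hsq ⊢
  set α := G a ^ ((j + 1 : ℝ)⁻¹)
  set β := G b ^ ((j + 1 : ℝ)⁻¹)
  set I := ∫ x in a..b, G x
  have hpowle : β ^ j ≤ α ^ j := pow_le_pow_left₀ hβ0 hβα j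
  rcases hα0.eq_or_lt with hα | hα
  · have hβ : β = 0 := le_antisymm (hβα.trans hα.ge) hβ0
    rw [← hα, hβ] at hkey
    have hI0 : I ≤ 0 := by
      by_contra hI'
      have : 0 < ((j : ℝ) + 2) * (D a * I) := by
        have := not_le.1 hI'
        positivity
      simp only [sub_self, mul_zero, zero_mul] at hkey
      linarith
    rw [le_antisymm hI0 hI]
    simpa using hsq
  · have hαj : 0 < α ^ j := by positivity
    refine le_of_mul_le_mul_right ?_ hαj
    calc (j + 2) * ((D a - D b) * I) * α ^ j
        = (j + 2) * ((D a * α ^ j - D b * α ^ j) * I) := by ring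
      _ ≤ (j + 2) * ((D a * α ^ j - D a * β ^ j) * I) := by gcongr
      _ = ((j + 2) * (D a * I)) * (α ^ j - β ^ j) := by ring
      _ ≤ ((j + 1) * (α ^ (j + 2) - β ^ (j + 2)) * α ^ j) * (α ^ j - β ^ j) :=
        mul_le_mul_of_nonneg_right hkey (sub_nonneg.2 hpowle)
      _ = (j + 1) * ((α ^ (j + 1) - β ^ (j + 1)) ^ 2 - α ^ j * β ^ j * (α - β) ^ 2) * α ^ j := by
        ring
      _ ≤ (j + 1) * (α ^ (j + 1) - β ^ (j + 1)) ^ 2 * α ^ j := by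
        gcongr
        have : 0 ≤ α ^ j * β ^ j * (α - β) ^ 2 := by positivity
        linarith

lemma hasDerivAt_window {G : ℝ → ℝ} (hG : Continuous G) (s : ℝ) :
    HasDerivAt (fun s => 1 / 2 * ∫ x in (s - 1)..(s + 1), G x)
      (-((G (s - 1) - G (s + 1)) / 2)) s := by
  have hprim : ∀ y, HasDerivAt (fun u => ∫ x in (0 : ℝ)..u, G x) (G y) y := fun y =>
    intervalIntegral.integral_hasDerivAt_right (hG.intervalIntegrable _ _)
      (hG.stronglyMeasurableAtFilter _ _) hG.continuousAt
  have h1 := (hprim (s + 1)).comp_add_const s 1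
  have h2 := (hprim (s - 1)).comp_sub_const s 1
  have hsplit : (fun s => 1 / 2 * ∫ x in (s - 1)..(s + 1), G x) = fun s =>
      1 / 2 * ((∫ x in (0 : ℝ)..(s + 1), G x) - ∫ x in (0 : ℝ)..(s - 1), G x) := by
    ext u
    rw [intervalIntegral.integral_interval_sub_left] <;> exact hG.intervalIntegrable _ _
  rw [hsplit]
  exact ((h1.sub h2).const_mul (1 / 2)).congr_deriv (by ring)

/-- Averaging over a window of length two improves the concavity exponent by one. -/
lemma window (h : RootConcaveTail j G D) :
    RootConcaveTail (j + 1) (fun s => 1 / 2 * ∫ x in (s - 1)..(s + 1), G x)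
      (fun s => (G (s - 1) - G (s + 1)) / 2) := by
  have hder := hasDerivAt_window h.continuous
  set F : ℝ → ℝ := fun s => 1 / 2 * ∫ x in (s - 1)..(s + 1), G x with hF
  set E : ℝ → ℝ := fun s => (G (s - 1) - G (s + 1)) / 2 with hE
  have hFc : Continuous F := continuous_iff_continuousAt.2 fun x => (hder x).continuousAt
  have hF0 : ∀ x, 0 ≤ F x := fun x => mul_nonneg (by norm_num)
    (intervalIntegral.integral_nonneg (by linarith) fun y _ => h.nonneg y)
  have hE0 : ∀ x, 0 ≤ E x := fun x =>
    div_nonneg (sub_nonneg.2 (h.antitone (by linarith))) (by norm_num)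
  have hEc : Continuous E := by have := h.continuous; fun_prop
  have hEder : ∀ x, HasDerivAt E ((D (x + 1) - D (x - 1)) / 2) x := fun x =>
    ((((h.hasDerivAt (x - 1)).comp_sub_const x 1).sub
      ((h.hasDerivAt (x + 1)).comp_add_const x 1)).div_const 2).congr_deriv (by ring)
  have hanti : Antitone F := antitone_of_deriv_nonpos (fun x => (hder x).differentiableAt)
    fun x => by rw [(hder x).deriv]; exact neg_nonpos.2 (hE0 x)
  refine ⟨hder, hEc, hF0, hE0, fun a b hab => ?_⟩
  push_cast
  set p : ℝ := (j + 1 + 1 : ℝ)⁻¹ with hp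
  rcases (hF0 b).eq_or_lt with hb | hb
  · rw [← hb, Real.zero_rpow (by positivity), zero_pow (Nat.succ_ne_zero j), mul_zero]
    exact mul_nonneg (hE0 b) (pow_nonneg (Real.rpow_nonneg (hF0 a) _) _)
  set r : ℝ := p * (j + 1) with hr
  have hpow : ∀ x, (F x ^ p) ^ (j + 1) = F x ^ r := fun x => by
    rw [← Real.rpow_natCast, ← Real.rpow_mul (hF0 x)]; push_cast; rfl
  have hpos : ∀ x ≤ b, 0 < F x := fun x hx => hb.trans_le (hanti hx)
  have hmono : MonotoneOn (fun x => E x * F x ^ (-r)) (Icc a b) := by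
    have hd : ∀ x ≤ b, HasDerivAt (fun x => E x * F x ^ (-r))
        ((D (x + 1) - D (x - 1)) / 2 * F x ^ (-r) + E x * (-E x * (-r) * F x ^ (-r - 1))) x :=
      fun x hx => (hEder x).mul ((hder x).rpow_const (Or.inl (hpos x hx).ne'))
    refine monotoneOn_of_deriv_nonneg (convex_Icc a b)
      (fun x hx => (hd x hx.2).continuousAt.continuousWithinAt)
      (fun x hx => (hd x (interior_subset hx).2).differentiableAt.differentiableWithinAt) ?_
    intro x hx
    have hxb := (interior_subset hx).2
    rw [(hd x hxb).deriv]
    have hkey := h.density_sub_mul_integral_le (show x - 1 ≤ x + 1 by linarith)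
    have hIF : ∫ y in (x - 1)..(x + 1), G y = 2 * F x := by simp only [hF]; ring
    have hGE : G (x - 1) - G (x + 1) = 2 * E x := by simp only [hE]; ring
    rw [hIF, hGE] at hkey
    have hsplit : F x ^ (-r) = F x ^ (-r - 1) * F x := by
      rw [← Real.rpow_add_one (hpos x hxb).ne']; ring_nf
    have hr' : r = (j + 1) / (j + 2) := by rw [hr, hp]; field_simp; ring
    have hfact : (D (x + 1) - D (x - 1)) / 2 * F x ^ (-r) + E x * (-E x * (-r) * F x ^ (-r - 1)) =
        F x ^ (-r - 1) * ((D (x + 1) - D (x - 1)) / 2 * F x + r * E x ^ 2) := by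
      rw [hsplit]; ring
    rw [hfact]
    refine mul_nonneg (Real.rpow_nonneg (hF0 x) _) ?_
    rw [hr']
    have : (D (x + 1) - D (x - 1)) / 2 * F x + (j + 1) / (j + 2) * E x ^ 2 =
        ((j + 1) * (2 * E x) ^ 2 - (j + 2) * ((D (x - 1) - D (x + 1)) * (2 * F x))) /
          (4 * (j + 2)) := by
      field_simp; ring
    rw [this]
    exact div_nonneg (by linarith) (by positivity)
  have hab' := hmono (left_mem_Icc.2 hab) (right_mem_Icc.2 hab) hab
  simp only [Real.rpow_neg (hF0 _)] at hab'
  rw [hpow, hpow]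
  have h1 := Real.rpow_pos_of_pos (hpos a hab) r
  have h2 := Real.rpow_pos_of_pos hb r
  rw [← div_eq_mul_inv, ← div_eq_mul_inv, div_le_div_iff₀ h1 h2] at hab'
  exact hab'

/-- The tail integral bound for a root-concave tail vanishing at the right end of the window. -/
lemma integral_mul_root_sub_le (h : RootConcaveTail j G D) {s b : ℝ} (hs : 0 < s) (hsb : s ≤ b)
    (hb : G b = 0) :
    (j + 2) * ((∫ x in s..b, G x) * (G 0 ^ ((j + 1 : ℝ)⁻¹) - G s ^ ((j + 1 : ℝ)⁻¹))) ≤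
      s * (G s ^ ((j + 1 : ℝ)⁻¹)) ^ (j + 2) := by
  have hkey := h.density_mul_integral_le hsb
  have hI : 0 ≤ ∫ x in s..b, G x := intervalIntegral.integral_nonneg hsb fun x _ => h.nonneg x
  rcases (h.nonneg s).eq_or_lt with hG | hG
  · have hI0 : ∫ x in s..b, G x = 0 := by
      refine (intervalIntegral.integral_congr (g := fun _ => 0) fun x hx => ?_).trans (by simp)
      rw [uIcc_of_le hsb] at hx
      exact le_antisymm (hG ▸ h.antitone hx.1) (h.nonneg x)
    rw [hI0, ← hG]
    have := Real.rpow_nonneg le_rfl ((j + 1 : ℝ)⁻¹)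
    simp only [zero_mul, mul_zero]
    positivity
  set p : ℝ := (j + 1 : ℝ)⁻¹ with hp
  have hp0 : 0 < p := by positivity
  have hpos : ∀ x ≤ s, 0 < G x := fun x hx => hG.trans_le (h.antitone hx)
  have hq : 0 < G s ^ p := Real.rpow_pos_of_pos hG p
  have hslope : (G s ^ p) ^ j * ((j + 1) * (G 0 ^ p - G s ^ p)) ≤ s * D s := by
    have hd : ∀ x ≤ s, HasDerivAt (fun x => G x ^ p) (-D x * p * G x ^ (p - 1)) x :=
      fun x hx => (h.hasDerivAt x).rpow_const (Or.inl (hpos x hx).ne')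
    obtain ⟨c, hc, hceq⟩ := exists_hasDerivAt_eq_slope (fun x => G x ^ p) _ hs
      (fun x hx => (hd x hx.2).continuousAt.continuousWithinAt) fun x hx => hd x hx.2.le
    have hGc := hpos c hc.2.le
    have hqc : 0 < G c ^ p := Real.rpow_pos_of_pos hGc p
    have hpow : G c ^ (p - 1) * (G c ^ p) ^ j = 1 := by
      rw [← Real.rpow_natCast, ← Real.rpow_mul hGc.le, ← Real.rpow_add hGc]
      have : p - 1 + p * j = 0 := by rw [hp]; field_simp; ring
      rw [this, Real.rpow_zero]
    have hratio := h.density_mul_le c s hc.2.le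
    rw [sub_zero, eq_div_iff hs.ne'] at hceq
    have hjp : (j + 1 : ℝ) * p = 1 := mul_inv_cancel₀ (by positivity)
    have h1 : (j + 1) * (G 0 ^ p - G s ^ p) * (G c ^ p) ^ j = s * D c := by
      calc (j + 1) * (G 0 ^ p - G s ^ p) * (G c ^ p) ^ j
          = -(j + 1) * (G s ^ p - G 0 ^ p) * (G c ^ p) ^ j := by ring
        _ = (j + 1) * p * (G c ^ (p - 1) * (G c ^ p) ^ j) * (s * D c) := by rw [← hceq]; ring
        _ = s * D c := by rw [hpow, hjp]; ring
    refine le_of_mul_le_mul_right ?_ (pow_pos hqc j)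
    calc (G s ^ p) ^ j * ((j + 1) * (G 0 ^ p - G s ^ p)) * (G c ^ p) ^ j
        = s * (D c * (G s ^ p) ^ j) := by linear_combination (G s ^ p) ^ j * h1
      _ ≤ s * (D s * (G c ^ p) ^ j) := mul_le_mul_of_nonneg_left hratio hs.le
      _ = s * D s * (G c ^ p) ^ j := by ring
  rw [hb, Real.zero_rpow hp0.ne', zero_pow (by omega), sub_zero] at hkey
  set I := ∫ x in s..b, G x
  set q := G s ^ p
  have hc : 0 < (j + 1 : ℝ) * q ^ j := by positivity
  refine le_of_mul_le_mul_left ?_ hc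
  calc (j + 1) * q ^ j * ((j + 2) * (I * (G 0 ^ p - q)))
      = (j + 2) * I * (q ^ j * ((j + 1) * (G 0 ^ p - q))) := by ring
    _ ≤ (j + 2) * I * (s * D s) := by gcongr
    _ = s * ((j + 2) * (D s * I)) := by ring
    _ ≤ s * ((j + 1) * q ^ (j + 2) * q ^ j) := by gcongr
    _ = (j + 1) * q ^ j * (s * q ^ (j + 2)) := by ring

end RootConcaveTail

lemma hasDerivAt_max_zero_sq (x : ℝ) : HasDerivAt (fun y : ℝ => max y 0 ^ 2) (2 * max x 0) x := by
  rcases lt_trichotomy x 0 with hx | rfl | hx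
  · rw [max_eq_right hx.le, mul_zero]
    refine (hasDerivAt_const x (0 : ℝ)).congr_of_eventuallyEq ?_
    filter_upwards [Iio_mem_nhds hx] with y hy
    simp [max_eq_right (show y ≤ 0 from le_of_lt hy)]
  · rw [max_self, mul_zero, hasDerivAt_iff_isLittleO_nhds_zero]
    simp only [zero_add, max_self, smul_zero, sub_zero, ne_eq, OfNat.ofNat_ne_zero,
      not_false_eq_true, zero_pow]
    refine Asymptotics.IsBigO.trans_isLittleO (g := fun y : ℝ => y ^ 2) ?_ ?_
    · refine Asymptotics.isBigO_of_le _ fun y => ?_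
      rw [norm_pow, norm_pow]
      refine pow_le_pow_left₀ (norm_nonneg _) ?_ 2
      simp only [Real.norm_eq_abs]
      grind
    · exact Asymptotics.isLittleO_pow_id one_lt_two
  · rw [max_eq_left hx.le]
    refine ((hasDerivAt_pow 2 x).congr_of_eventuallyEq ?_).congr_deriv (by simp)
    filter_upwards [Ioi_mem_nhds hx] with y hy
    rw [max_eq_left (show 0 ≤ y from le_of_lt hy)]

lemma integral_sumTail_one (a b : ℝ) : ∫ x in a..b, sumTail 1 x =
    (max (1 - a) 0 ^ 2 - max (-1 - a) 0 ^ 2 - max (1 - b) 0 ^ 2 + max (-1 - b) 0 ^ 2) / 4 := by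
  rw [intervalIntegral.integral_eq_sub_of_hasDerivAt
    (f := fun x => (max (-1 - x) 0 ^ 2 - max (1 - x) 0 ^ 2) / 4)]
  · ring
  · intro x _
    have h1 := (hasDerivAt_max_zero_sq (1 - x)).comp_const_sub 1 x
    have h2 := (hasDerivAt_max_zero_sq (-1 - x)).comp_const_sub (-1) x
    refine ((h2.sub h1).div_const 4).congr_deriv ?_
    rw [sumTail_one]; ring
  · exact intervalIntegrable_sumTail 1 a b

lemma rootConcaveTail_sumTail_two :
    RootConcaveTail 1 (sumTail 2) (fun s => (sumTail 1 (s - 1) - sumTail 1 (s + 1)) / 2) := by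
  have hG : sumTail 2 = fun s => 1 / 2 * ∫ x in (s - 1)..(s + 1), sumTail 1 x :=
    funext (sumTail_succ 1)
  have hc := continuous_sumTail_succ 0
  rw [zero_add] at hc
  have hD0 : ∀ x, 0 ≤ (sumTail 1 (x - 1) - sumTail 1 (x + 1)) / 2 := fun x =>
    div_nonneg (sub_nonneg.2 (sumTail_antitone 1 (by linarith))) (by norm_num)
  refine ⟨fun x => ?_, by fun_prop, sumTail_nonneg 2, hD0, fun a x hax => ?_⟩
  · rw [hG]
    exact RootConcaveTail.hasDerivAt_window hc x
  set D : ℝ → ℝ := fun s => (sumTail 1 (s - 1) - sumTail 1 (s + 1)) / 2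
  have hDeq : ∀ s, D s = max (2 - |s|) 0 / 4 := by
    intro s
    simp only [D, sumTail_one]
    grind
  have hTail : ∀ s, sumTail 2 s = if 0 ≤ s then 2 * D s ^ 2 else 1 - 2 * D s ^ 2 := by
    intro s
    rw [hDeq, sumTail_succ, integral_sumTail_one]
    split_ifs with hs
    · rw [abs_of_nonneg hs, max_eq_right (show -1 - (s - 1) ≤ 0 by linarith),
        max_eq_right (show 1 - (s + 1) ≤ 0 by linarith),
        max_eq_right (show -1 - (s + 1) ≤ 0 by linarith)]
      ring_nf
    · have hs := not_le.1 hs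
      rw [abs_of_neg hs, max_eq_left (show 0 ≤ -1 - (s - 1) by linarith),
        max_eq_left (show 0 ≤ 1 - (s + 1) by linarith),
        max_eq_left (show 0 ≤ 1 - (s - 1) by linarith)]
      rcases le_total s (-2) with h2 | h2
      · rw [max_eq_left (show 0 ≤ -1 - (s + 1) by linarith),
          max_eq_right (show 2 - -s ≤ 0 by linarith)]
        ring
      · rw [max_eq_right (show -1 - (s + 1) ≤ 0 by linarith),
          max_eq_left (show 0 ≤ 2 - -s by linarith)]
        ring
  have hle : ∀ s, D s ≤ 1 / 2 := by intro s; rw [hDeq]; grind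
  have hsq : D a ^ 2 * sumTail 2 x ≤ D x ^ 2 * sumTail 2 a := by
    have ha := hle a
    have ha0 := hD0 a
    rw [hTail, hTail]
    split_ifs with hx hx' hx'
    · exact le_of_eq (by ring)
    · have : D a ^ 2 ≤ (1 / 2) ^ 2 := pow_le_pow_left₀ ha0 ha 2
      nlinarith [sq_nonneg (D x)]
    · linarith
    · have hmono : D a ≤ D x := by rw [hDeq, hDeq]; grind
      have : D a ^ 2 ≤ D x ^ 2 := pow_le_pow_left₀ ha0 hmono 2
      linarith
  have hexp : ((1 : ℕ) + 1 : ℝ)⁻¹ = 1 / 2 := by norm_num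
  simp only [pow_one, hexp, ← Real.sqrt_eq_rpow]
  have := Real.sqrt_le_sqrt hsq
  rwa [Real.sqrt_mul (sq_nonneg _), Real.sqrt_mul (sq_nonneg _), Real.sqrt_sq (hD0 a),
    Real.sqrt_sq (hD0 x)] at this

lemma exists_rootConcaveTail_sumTail (j : ℕ) :
    ∃ D, RootConcaveTail (j + 1) (sumTail (j + 2)) D := by
  induction j with
  | zero => exact ⟨_, rootConcaveTail_sumTail_two⟩
  | succ j ih =>
    obtain ⟨D, hD⟩ := ih
    rw [show sumTail (j + 1 + 2) = _ from funext (sumTail_succ (j + 2))]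
    exact ⟨_, hD.window⟩

lemma integral_sumTail_mul_root_sub_le {n : ℕ} (hn : 0 < n) {s b : ℝ} (hs : 0 < s)
    (hsn : s ≤ n) (hb : n ≤ b) :
    (n + 1) * ((∫ x in s..b, sumTail n x) *
        (sumTail n 0 ^ ((1 : ℝ) / n) - sumTail n s ^ ((1 : ℝ) / n))) ≤
      s * (sumTail n s ^ ((1 : ℝ) / n)) ^ (n + 1) := by
  rcases n with _ | _ | j
  · exact absurd hn (lt_irrefl 0)
  · norm_num at hsn hb ⊢
    rw [integral_sumTail_one, sumTail_one, sumTail_one, max_eq_left (sub_nonneg.2 hsn),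
      max_eq_right (show -1 - s ≤ 0 by linarith), max_eq_right (show 1 - b ≤ 0 by linarith),
      max_eq_right (show -1 - b ≤ 0 by linarith)]
    norm_num
    exact le_of_eq (by ring)
  · obtain ⟨D, hD⟩ := exists_rootConcaveTail_sumTail j
    have := hD.integral_mul_root_sub_le hs (hsn.trans hb) (sumTail_eq_zero hb)
    push_cast at this ⊢
    have e1 : (j + 1 + 1 + 1 : ℝ) = j + 1 + 2 := by ring
    rw [one_div, e1]
    exact this

lemma div_add_one_le_half_rpow {n : ℕ} (hn : 0 < n) :
    (n : ℝ) / (n + 1) ≤ (1 / 2 : ℝ) ^ ((1 : ℝ) / n) := by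
  have hn' : (0 : ℝ) < n := by exact_mod_cast hn
  have hbern := one_add_mul_le_pow (a := (n : ℝ)⁻¹) (by linarith [inv_pos.2 hn']) n
  rw [mul_inv_cancel₀ hn'.ne'] at hbern
  have hpow : ((n : ℝ) / (n + 1)) ^ n ≤ 1 / 2 := by
    have : (n : ℝ) / (n + 1) = (1 + (n : ℝ)⁻¹)⁻¹ := by field_simp
    rw [this, inv_pow, one_div]
    exact inv_anti₀ two_pos (by linarith)
  calc (n : ℝ) / (n + 1) = (((n : ℝ) / (n + 1)) ^ n) ^ ((1 : ℝ) / n) := by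
        rw [one_div, Real.pow_rpow_inv_natCast (by positivity) hn.ne']
    _ ≤ _ := Real.rpow_le_rpow (by positivity) hpow (by positivity)

/-- For the average `X` of `n` i.i.d. uniform random variables on `[-1,1]` and every
`t ∈ (0,1)` with `p_X(t)^(1/n) < n/(n+1)`, one has
`m_X(t)/t ≤ 1 + p_X(t)^(1/n) / (n - (n+1) p_X(t)^(1/n))`. -/
theorem truncMean_div_le (n : ℕ) (hn : 0 < n) :
    ∀ t ∈ Ioo (0 : ℝ) 1, tailP n t ^ ((1 : ℝ) / n) < n / (n + 1) →
      truncMean n t / t ≤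
        1 + tailP n t ^ ((1 : ℝ) / n)
          / ((n : ℝ) - (n + 1) * tailP n t ^ ((1 : ℝ) / n)) := by
  intro t ⟨ht0, ht1⟩ hq
  have hn' : (0 : ℝ) < n := by exact_mod_cast hn
  rw [truncMean, setIntegral_avgCoord hn ht0]
  have hnt : 0 < n * t := mul_pos hn' ht0
  have hbound := integral_sumTail_mul_root_sub_le hn hnt (by nlinarith)
    (show (n : ℝ) ≤ n * t + n by linarith)
  rw [← tailP_eq_sumTail hn] at hbound
  have hp0 : 0 ≤ tailP n t := ENNReal.toReal_nonneg
  have hhalf : sumTail n 0 = 1 / 2 := by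
    obtain ⟨m, rfl⟩ := Nat.exists_eq_succ_of_ne_zero hn.ne'
    have := sumTail_add_sumTail_neg m 0
    rw [neg_zero] at this
    linarith
  rw [hhalf] at hbound
  have hroot := div_add_one_le_half_rpow hn
  have hqn : (tailP n t ^ ((1 : ℝ) / n)) ^ n = tailP n t := by
    rw [one_div, Real.rpow_inv_natCast_pow hp0 hn.ne']
  have hq0 : 0 ≤ tailP n t ^ ((1 : ℝ) / n) := Real.rpow_nonneg hp0 _
  have hI : 0 ≤ ∫ x in (n * t)..(n * t + n), sumTail n x :=
    intervalIntegral.integral_nonneg (by linarith) fun x _ => sumTail_nonneg n x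
  set I := ∫ x in (n * t)..(n * t + n), sumTail n x
  rw [pow_succ, hqn] at hbound
  set q := tailP n t ^ ((1 : ℝ) / n)
  rw [lt_div_iff₀ (by positivity)] at hq
  rw [div_le_iff₀ (by positivity)] at hroot
  have hden : 0 < (n : ℝ) - (n + 1) * q := by linarith
  rcases hp0.eq_or_lt with hp | hp
  · rw [← hp, div_zero, zero_div]
    positivity
  have hmain : I * (n - (n + 1) * q) ≤ n * t * (tailP n t * q) := by
    refine le_trans ?_ hbound
    rw [mul_left_comm]
    exact mul_le_mul_of_nonneg_left (by linarith) hI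
  have hsplit : (t * tailP n t + I / n) / tailP n t / t = 1 + I / (n * t * tailP n t) := by
    field_simp
  rw [hsplit, add_le_add_iff_left, div_le_div_iff₀ (by positivity) hden]
  linarith
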